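/- arXiv:2502.12306 — 7 statements merged into one kernel-verified Lean document; each statement's English description precedes it below -/
import Mathlib

section
/- The WillyWonka mechanism is individually rational, has normalized payments, and is budget-feasible: for every declared cost profile c ∈ [0,B]^n its output (x,p) satisfies p_i(c) ≥ c_i·x_i(c) for all i, p_i(c) = 0 whenever x_i(c) = 0, and Σ_{i∈N} p_i(c) ≤ B. -/
open Finset

/-- The set of declared cost profiles lying in the box `[0,B]^n`. -/
def InBox {n : ℕ} (B : ℝ) (c : Fin n → ℝ) : Prop := ∀ i, c i ∈ Set.Icc (0:ℝ) B

/-- Agent `i` holds their golden ticket at profile `c`: `c i < B` and every other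
agent `j` declares `0` if `j < i` and `B` if `j > i`. -/
def isGT {n : ℕ} (B : ℝ) (c : Fin n → ℝ) (i : Fin n) : Prop :=
  c i < B ∧ ∀ j, j ≠ i → c j = if j < i then 0 else B

/-- Agent `i` holds their wooden spoon at profile `c`: `c i < B` and every other
agent declares `B` if `i` is the last agent, and `0` otherwise. -/
def isWS {n : ℕ} (B : ℝ) (c : Fin n → ℝ) (i : Fin n) : Prop :=
  c i < B ∧ ∀ j, j ≠ i → c j = if (i : ℕ) = n - 1 then B else 0

open Classical in
/-- The WillyWonka mechanism on `n+2` agents (agents are already renamed so that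
`V {0} ≥ V {1} ≥ … ≥ V {n+1}`): it returns the (0/1-valued) allocation and the
payments at a declared cost profile `c`. -/
noncomputable def willyWonka {n : ℕ} (B : ℝ)
    (APX : (Fin (n+2) → ℝ) → Finset (Fin (n+2))) (c : Fin (n+2) → ℝ) :
    (Fin (n+2) → ℝ) × (Fin (n+2) → ℝ) :=
  if hg : ∃ i, isGT B c i then
    -- smallest agent holding their golden ticket
    let i := (Finset.univ.filter (isGT B c)).min'
      (by obtain ⟨i, hi⟩ := hg
          exact ⟨i, Finset.mem_filter.mpr ⟨Finset.mem_univ i, hi⟩⟩)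
    (fun j => if j ≤ i then 1 else 0, fun j => if j = i then B else 0)
  else if hs : ∃ i, isWS B c i then
    -- smallest agent holding their wooden spoon
    let i := (Finset.univ.filter (isWS B c)).min'
      (by obtain ⟨i, hi⟩ := hs
          exact ⟨i, Finset.mem_filter.mpr ⟨Finset.mem_univ i, hi⟩⟩)
    if (i : ℕ) = n + 1 then
      (fun j => if j = 0 then 1 else 0, fun j => if j = 0 then B else 0)
    else
      (fun j => if j = i then 0 else 1, fun _ => 0)
  else
    (fun j => if j ∈ APX c then 1 else 0, fun j => if j ∈ APX c then c j else 0)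

/-- The WillyWonka mechanism is individually rational, has normalized
payments, and is budget-feasible. -/
theorem willyWonka_IR_NP_BF (n : ℕ) (B : ℝ) (hB : 0 < B)
    (V : Finset (Fin (n+2)) → ℝ)
    (hV0 : V ∅ = 0) (hVnonneg : ∀ S, 0 ≤ V S)
    (hVmono : ∀ S T : Finset (Fin (n+2)), S ⊆ T → V S ≤ V T)
    (hVsorted : ∀ i j : Fin (n+2), i ≤ j → V {j} ≤ V {i})
    (APX : (Fin (n+2) → ℝ) → Finset (Fin (n+2)))
    (hAPXfeas : ∀ c, InBox B c → ∑ i ∈ APX c, c i ≤ B)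
    (hAPX0 : ∀ c, InBox B c → ∀ i, c i = 0 → i ∈ APX c) :
    ∀ c, InBox B c →
      (∀ i, c i * (willyWonka B APX c).1 i ≤ (willyWonka B APX c).2 i) ∧
      (∀ i, (willyWonka B APX c).1 i = 0 → (willyWonka B APX c).2 i = 0) ∧
      (∑ i, (willyWonka B APX c).2 i ≤ B) := by
  intro c hc
  classical
  unfold willyWonka
  split_ifs with hg hs
  · have hi := (Finset.mem_filter.mp
      ((Finset.univ.filter (isGT B c)).min'_mem (by simpa [Finset.Nonempty] using hg))).2
    dsimp only
    generalize (Finset.univ.filter (isGT B c)).min' _ = i at hi ⊢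
    refine ⟨fun j => ?_, fun j hj => ?_, by simp⟩
    · rcases lt_trichotomy j i with hji | rfl | hij
      · have hcj := hi.2 j hji.ne
        rw [if_pos hji] at hcj
        simp [hcj, hji.ne]
      · simpa using (hc j).2
      · simp [hij.not_ge, hij.ne']
    · have hne : j ≠ i := by
        rintro rfl
        simp at hj
      simp [hne]
  · have hi := (Finset.mem_filter.mp
      ((Finset.univ.filter (isWS B c)).min'_mem (by simpa [Finset.Nonempty] using hs))).2
    dsimp only
    generalize (Finset.univ.filter (isWS B c)).min' _ = i at hi ⊢
    split_ifs with hlast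
    · refine ⟨fun j => ?_, fun j hj => ?_, by simp⟩
      · by_cases hj : j = 0
        · simpa [hj] using (hc 0).2
        · simp [hj]
      · have hne : j ≠ 0 := by
          rintro rfl
          simp at hj
        simp [hne]
    · refine ⟨fun j => ?_, fun _ _ => rfl, by simpa using hB.le⟩
      by_cases hj : j = i
      · simp [hj]
      · have hcj := hi.2 j hj
        rw [if_neg (by simpa using hlast)] at hcj
        simp [hcj]
  · refine ⟨fun j => ?_, fun j hj => ?_, ?_⟩
    · by_cases hj : j ∈ APX c <;> simp [hj]
    · have hnot : j ∉ APX c := by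
        intro hmem
        simp [hmem] at hj
      simp [hnot]
    · simpa [Finset.sum_ite_mem] using hAPXfeas c hc
end

section
/- If V is additionally subadditive and APX is γ-approximate for some γ ≥ 1, then the MaxOrWillyWonka mechanism is max{2,γ}-approximate: for every c ∈ [0,B]^n, max{2,γ}·V(X(c)) ≥ V*(c), where X(c) = {i : x_i(c) = 1} is the set of agents it selects and V*(c) = max{V(S) : S ⊆ N, Σ_{i∈S} c_i ≤ B}. -/
open Finset

open Classical in
/-- The MaxOrWillyWonka mechanism: if agent `istar` alone is valuable enough, select
`istar` and pay them the whole budget `B`; otherwise run the WillyWonka mechanism. -/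
noncomputable def maxOrWW {n : ℕ} (B : ℝ) (V : Finset (Fin (n+2)) → ℝ)
    (istar : Fin (n+2)) (APX : (Fin (n+2) → ℝ) → Finset (Fin (n+2)))
    (c : Fin (n+2) → ℝ) : (Fin (n+2) → ℝ) × (Fin (n+2) → ℝ) :=
  if V (Finset.univ.erase istar) ≤ V {istar} then
    (fun j => if j = istar then 1 else 0, fun j => if j = istar then B else 0)
  else willyWonka B APX c

/-- If every agent outside `T` costs the whole budget and is worth at most `v`, then no
budget-feasible set is worth more than `V T + v`. -/
theorem value_le_add_of_cost_eq_budget {ι : Type*} [DecidableEq ι] {B : ℝ} (hB : 0 < B)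
    {V : Finset ι → ℝ} (hVmono : ∀ S T, S ⊆ T → V S ≤ V T)
    (hVsub : ∀ S T, V (S ∪ T) ≤ V S + V T) {c : ι → ℝ} (hc : ∀ i, 0 ≤ c i)
    {S T : Finset ι} (hS : ∑ i ∈ S, c i ≤ B) {v : ℝ} (hv : 0 ≤ v)
    (hT : ∀ j, j ∉ T → c j = B ∧ V {j} ≤ v) : V S ≤ V T + v := by
  by_cases h : ∃ j ∈ S, j ∉ T
  · obtain ⟨j, hjS, hjT⟩ := h
    have hsub : S ⊆ T ∪ {j} := by
      intro k hk
      by_contra hkT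
      simp only [mem_union, mem_singleton, not_or] at hkT
      have hpair : ∑ i ∈ ({k, j} : Finset ι), c i ≤ ∑ i ∈ S, c i :=
        sum_le_sum_of_subset_of_nonneg (by simp [insert_subset_iff, hk, hjS])
          (fun i _ _ => hc i)
      rw [sum_pair hkT.2, (hT k hkT.1).1, (hT j hjT).1] at hpair
      linarith
    linarith [hVmono _ _ hsub, hVsub T {j}, (hT j hjT).2]
  · push Not at h
    linarith [hVmono S T h]

/-- The possible outcomes of the WillyWonka allocation rule. -/
theorem willyWonka_alloc_cases {n : ℕ} (B : ℝ)
    (APX : (Fin (n+2) → ℝ) → Finset (Fin (n+2))) (c : Fin (n+2) → ℝ) :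
    (∃ i, isGT B c i ∧ ∀ j, (willyWonka B APX c).1 j = 1 ↔ j ≤ i) ∨
    (∃ i, isWS B c i ∧ (i : ℕ) = n + 1 ∧ ∀ j, (willyWonka B APX c).1 j = 1 ↔ j = 0) ∨
    (∃ i, ∀ j, (willyWonka B APX c).1 j = 1 ↔ j ≠ i) ∨
    (∀ j, (willyWonka B APX c).1 j = 1 ↔ j ∈ APX c) := by
  classical
  by_cases hg : ∃ i, isGT B c i
  · left
    have hne : (univ.filter (isGT B c)).Nonempty := by
      obtain ⟨i, hi⟩ := hg
      exact ⟨i, by simpa using hi⟩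
    refine ⟨_, (mem_filter.mp (min'_mem _ hne)).2, fun j => ?_⟩
    unfold willyWonka
    rw [dif_pos hg]
    simp
  · by_cases hs : ∃ i, isWS B c i
    · have hne : (univ.filter (isWS B c)).Nonempty := by
        obtain ⟨i, hi⟩ := hs
        exact ⟨i, by simpa using hi⟩
      right
      by_cases hi : (((univ.filter (isWS B c)).min' hne : Fin (n+2)) : ℕ) = n + 1
      · left
        refine ⟨_, (mem_filter.mp (min'_mem _ hne)).2, hi, fun j => ?_⟩
        unfold willyWonka
        rw [dif_neg hg, dif_pos hs]
        dsimp only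
        rw [if_pos (by convert hi)]
        simp
      · right; left
        refine ⟨(univ.filter (isWS B c)).min' hne, fun j => ?_⟩
        unfold willyWonka
        rw [dif_neg hg, dif_pos hs]
        dsimp only
        rw [if_neg (by convert hi)]
        simp
    · right; right; right
      intro j
      unfold willyWonka
      rw [dif_neg hg, dif_neg hs]
      simp

open Classical in
/-- If `V` is moreover subadditive and `APX` is a `γ`-approximation
algorithm for the underlying packing problem, then MaxOrWillyWonka is
`max {2, γ}`-approximate: for every profile `c ∈ [0,B]^n` and every budget-feasible
set `S`, `V S ≤ max {2, γ} * V (X(c))` where `X(c)` is the set of selected agents. -/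
theorem maxOrWW_approx (n : ℕ) (B : ℝ) (hB : 0 < B)
    (V : Finset (Fin (n+2)) → ℝ)
    (hV0 : V ∅ = 0) (hVnonneg : ∀ S, 0 ≤ V S)
    (hVmono : ∀ S T : Finset (Fin (n+2)), S ⊆ T → V S ≤ V T)
    (hVsub : ∀ S T : Finset (Fin (n+2)), V (S ∪ T) ≤ V S + V T)
    (hVsorted : ∀ i j : Fin (n+2), i ≤ j → V {j} ≤ V {i})
    (hVpos : ∀ i : Fin (n+2), 0 < V (Finset.univ.erase i))
    (istar : Fin (n+2))
    (histar_max : ∀ j : Fin (n+2),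
      V {j} / V (Finset.univ.erase j) ≤ V {istar} / V (Finset.univ.erase istar))
    (histar_min : ∀ j : Fin (n+2),
      V {istar} / V (Finset.univ.erase istar) ≤ V {j} / V (Finset.univ.erase j) →
        istar ≤ j)
    (γ : ℝ) (hγ : 1 ≤ γ)
    (APX : (Fin (n+2) → ℝ) → Finset (Fin (n+2)))
    (hAPXfeas : ∀ c, InBox B c → ∑ i ∈ APX c, c i ≤ B)
    (hAPX0 : ∀ c, InBox B c → ∀ i, c i = 0 → i ∈ APX c)
    (hAPXapprox : ∀ c, InBox B c → ∀ S : Finset (Fin (n+2)),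
      ∑ i ∈ S, c i ≤ B → V S ≤ γ * V (APX c)) :
    ∀ c, InBox B c → ∀ S : Finset (Fin (n+2)), ∑ i ∈ S, c i ≤ B →
      V S ≤ max 2 γ *
        V (Finset.univ.filter (fun i => (maxOrWW B V istar APX c).1 i = 1)) := by
  intro c hc S hS
  have hc0 : ∀ i, 0 ≤ c i := fun i => (hc i).1
  set X := Finset.univ.filter (fun i => (maxOrWW B V istar APX c).1 i = 1) with hX
  have hmem : ∀ j, j ∈ X ↔ (maxOrWW B V istar APX c).1 j = 1 := by simp [hX]
  have of_two : V S ≤ 2 * V X → V S ≤ max 2 γ * V X := fun h =>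
    h.trans (mul_le_mul_of_nonneg_right (le_max_left _ _) (hVnonneg _))
  have hsplit : ∀ i, V S ≤ V {i} + V (univ.erase i) := fun i => by
    refine (hVmono S ({i} ∪ univ.erase i) fun j _ => ?_).trans (hVsub _ _)
    by_cases h : j = i <;> simp [h]
  by_cases hstar : V (univ.erase istar) ≤ V {istar}
  · have hXeq : X = {istar} := by
      ext j
      rw [hmem, maxOrWW, if_pos hstar]
      simp
    apply of_two
    rw [hXeq]
    linarith [hsplit istar]
  have hmem' : ∀ j, j ∈ X ↔ (willyWonka B APX c).1 j = 1 := fun j => by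
    rw [hmem, maxOrWW, if_neg hstar]
  rcases willyWonka_alloc_cases B APX c with
    ⟨i, hi, hx⟩ | ⟨i, hi, hin, hx⟩ | ⟨i, hx⟩ | hx
  · apply of_two
    have hbound : V S ≤ V X + V {i} := by
      refine value_le_add_of_cost_eq_budget hB hVmono hVsub hc0 hS (hVnonneg _) fun j hj => ?_
      rw [hmem', hx, not_le] at hj
      exact ⟨by rw [hi.2 j hj.ne', if_neg hj.not_gt], hVsorted i j hj.le⟩
    have hiX : V {i} ≤ V X :=
      hVmono _ _ (singleton_subset_iff.mpr (by rw [hmem', hx]))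
    linarith
  · apply of_two
    have hXeq : X = {0} := by
      ext j
      rw [hmem', hx, mem_singleton]
    have hbound : V S ≤ V {i} + V {0} := by
      refine value_le_add_of_cost_eq_budget hB hVmono hVsub hc0 hS (hVnonneg _) fun j hj => ?_
      rw [mem_singleton] at hj
      exact ⟨by rw [hi.2 j hj, if_pos (by simpa using hin)], hVsorted 0 j (Fin.zero_le j)⟩
    rw [hXeq]
    linarith [hVsorted 0 i (Fin.zero_le i)]
  · apply of_two
    have hXeq : X = univ.erase i := by
      ext j
      rw [hmem', hx]
      simp
    have hlt : V {i} / V (univ.erase i) < 1 :=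
      (histar_max i).trans_lt ((div_lt_one (hVpos istar)).mpr (not_le.mp hstar))
    rw [div_lt_one (hVpos i)] at hlt
    rw [hXeq]
    linarith [hsplit i]
  · have hXeq : X = APX c := by
      ext j
      rw [hmem', hx]
    rw [hXeq]
    exact (hAPXapprox c hc S hS).trans
      (mul_le_mul_of_nonneg_right (le_max_right _ _) (hVnonneg _))
end

section
/- Let M be a deterministic mechanism satisfying NP, IR and WNOM. Then guaranteed selection is downward closed in an agent's declared cost: for every agent i and all c_i', c_i ∈ [0,B] with c_i' < c_i, if x_i(c_i, c_{−i}) = 1 for all c_{−i} ∈ [0,B]^{n−1}, then x_i(c_i', c_{−i}) = 1 for all c_{−i} ∈ [0,B]^{n−1}. -/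
open Finset

/-- The set of utilities agent `i` with true cost `t` can experience when reporting `ci`,
as the reports of the other agents range over `[0,B]^{n-1}`. -/
def utilSet {n : ℕ} (B : ℝ) (x p : (Fin n → ℝ) → Fin n → ℝ) (i : Fin n) (t ci : ℝ) :
    Set ℝ :=
  {u | ∃ c : Fin n → ℝ, c i = ci ∧ (∀ j, j ≠ i → c j ∈ Set.Icc (0:ℝ) B) ∧
    u = p c i - t * x c i}

/-- Best-case non-obvious manipulability. -/
def BNOM {n : ℕ} (B : ℝ) (x p : (Fin n → ℝ) → Fin n → ℝ) : Prop :=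
  ∀ i : Fin n, ∀ t ∈ Set.Icc (0:ℝ) B, ∀ ci ∈ Set.Icc (0:ℝ) B,
    sSup (utilSet B x p i t ci) ≤ sSup (utilSet B x p i t t)

/-- Worst-case non-obvious manipulability. -/
def WNOM {n : ℕ} (B : ℝ) (x p : (Fin n → ℝ) → Fin n → ℝ) : Prop :=
  ∀ i : Fin n, ∀ t ∈ Set.Icc (0:ℝ) B, ∀ ci ∈ Set.Icc (0:ℝ) B,
    sInf (utilSet B x p i t ci) ≤ sInf (utilSet B x p i t t)

/-- For a mechanism satisfying NP, IR and WNOM, guaranteed selection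
is downward closed in an agent's declared cost: if agent `i` is always selected when
declaring `ci`, then `i` is always selected when declaring any lower cost `ci'`. -/
theorem wnom_guaranteed_selection_downward_closed (n : ℕ) (hn : 2 ≤ n)
    (B : ℝ) (hB : 0 < B)
    (x p : (Fin n → ℝ) → Fin n → ℝ)
    (hx01 : ∀ c, InBox B c → ∀ i, x c i = 0 ∨ x c i = 1)
    (hp0 : ∀ c, InBox B c → ∀ i, 0 ≤ p c i)
    (hNP : ∀ c, InBox B c → ∀ i, x c i = 0 → p c i = 0)
    (hIR : ∀ c, InBox B c → ∀ i, c i * x c i ≤ p c i)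
    (hWNOM : WNOM B x p) :
    ∀ i : Fin n, ∀ ci' ∈ Set.Icc (0:ℝ) B, ∀ ci ∈ Set.Icc (0:ℝ) B, ci' < ci →
      (∀ c : Fin n → ℝ, c i = ci → (∀ j, j ≠ i → c j ∈ Set.Icc (0:ℝ) B) → x c i = 1) →
      (∀ c : Fin n → ℝ, c i = ci' → (∀ j, j ≠ i → c j ∈ Set.Icc (0:ℝ) B) → x c i = 1) := by
  intro i ci' hci' ci hci hlt hall c hc hbox
  have inBox_of : ∀ t ∈ Set.Icc (0:ℝ) B, ∀ d : Fin n → ℝ, d i = t →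
      (∀ j, j ≠ i → d j ∈ Set.Icc (0:ℝ) B) → InBox B d := by
    intro t ht d hd hdj j
    by_cases hj : j = i
    · rw [hj, hd]
      exact ht
    · exact hdj j hj
  have hcB := inBox_of ci' hci' c hc hbox
  refine (hx01 c hcB i).resolve_left fun hx => ?_
  have truthful_le : sInf (utilSet B x p i ci' ci') ≤ 0 := by
    refine csInf_le ⟨0, ?_⟩ ⟨c, hc, hbox, by simp [hx, hNP c hcB i hx]⟩
    rintro u ⟨d, hd, hdj, rfl⟩
    have h := hIR d (inBox_of ci' hci' d hd hdj) i
    rw [hd] at h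
    linarith
  have le_misreport : ci - ci' ≤ sInf (utilSet B x p i ci' ci) := by
    refine le_csInf ⟨_, fun _ => ci, rfl, fun _ _ => hci, rfl⟩ ?_
    rintro u ⟨d, hd, hdj, rfl⟩
    have h := hIR d (inBox_of ci hci d hd hdj) i
    rw [hd, hall d hd hdj] at h
    rw [hall d hd hdj]
    linarith
  linarith [hWNOM i ci' hci' ci hci]
end

section
/- The selection rule X1 is monotone in agent 1's declared cost: for all c_1, c_1' ∈ [0,B] with c_1' < c_1 and all c_{−1} ∈ [0,B]^{n−1}, if 1 ∈ X1((c_1,c_{−1}),B) then 1 ∈ X1((c_1',c_{−1}),B). -/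
open Finset

/-- A set `S` of agents is budget-feasible at cost profile `c`. -/
def Feasible {n : ℕ} (B : ℝ) (c : Fin n → ℝ) (S : Finset (Fin n)) : Prop :=
  ∑ i ∈ S, c i ≤ B

/-- The golden ratio `φ = (1 + √5)/2`. -/
noncomputable def phi : ℝ := (1 + Real.sqrt 5) / 2

open Classical in
/-- The selection rule `X1`: choose `Xge2 c` (the tie-broken optimal solution excluding
agent `0`) whenever `V (Xstar c) < φ * V (Xge2 c)`, and the tie-broken overall optimal
solution `Xstar c` otherwise. -/
noncomputable def X1 {n : ℕ} (V : Finset (Fin (n+2)) → ℝ)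
    (Xstar Xge2 : (Fin (n+2) → ℝ) → Finset (Fin (n+2))) (c : Fin (n+2) → ℝ) :
    Finset (Fin (n+2)) :=
  if V (Xstar c) < phi * V (Xge2 c) then Xge2 c else Xstar c

/-- Lowering the cost of one agent preserves feasibility. -/
theorem Feasible.update_of_le {n : ℕ} {B : ℝ} {c : Fin n → ℝ} {S : Finset (Fin n)}
    (hS : Feasible B c S) {i : Fin n} {x : ℝ} (hx : x ≤ c i) :
    Feasible B (Function.update c i x) S :=
  (Finset.sum_le_sum fun j _ => update_le_self_iff.2 hx j).trans hS

/-- The feasibility of a set does not depend on the cost of an agent outside it. -/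
theorem feasible_update_iff_of_notMem {n : ℕ} {B : ℝ} {c : Fin n → ℝ} {S : Finset (Fin n)}
    {i : Fin n} {x : ℝ} (hi : i ∉ S) :
    Feasible B (Function.update c i x) S ↔ Feasible B c S := by
  rw [Feasible, Feasible, Finset.sum_update_of_notMem hi]

/-- The selection rule `X1` is monotone in agent `0`'s declared
cost: if agent `0` is selected at report `c 0` then they are also selected at any
lower report `c1' < c 0` (other reports unchanged). -/
theorem X1_monotone_in_agent0 (n : ℕ) (B : ℝ) (hB : 0 < B)
    (V : Finset (Fin (n+2)) → ℝ) (hVnonneg : ∀ S, 0 ≤ V S)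
    (r : Finset (Fin (n+2)) → Finset (Fin (n+2)) → Prop)
    (hr : IsStrictTotalOrder (Finset (Fin (n+2))) r)
    (hrcard : ∀ S T : Finset (Fin (n+2)), T.card < S.card → r S T)
    (Xstar Xge2 : (Fin (n+2) → ℝ) → Finset (Fin (n+2)))
    (hXstar : ∀ c, InBox B c → Feasible B c (Xstar c) ∧
      (∀ S, Feasible B c S → V S ≤ V (Xstar c)) ∧
      (∀ S, Feasible B c S → V S = V (Xstar c) → S ≠ Xstar c → r (Xstar c) S))
    (hXge2 : ∀ c, InBox B c → Xge2 c ⊆ Finset.univ.erase 0 ∧ Feasible B c (Xge2 c) ∧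
      (∀ S ⊆ Finset.univ.erase 0, Feasible B c S → V S ≤ V (Xge2 c)) ∧
      (∀ S ⊆ Finset.univ.erase 0, Feasible B c S → V S = V (Xge2 c) → S ≠ Xge2 c →
        r (Xge2 c) S))
    (hXge2const : ∀ c c' : Fin (n+2) → ℝ, (∀ j, j ≠ 0 → c j = c' j) → Xge2 c = Xge2 c')
    :
    ∀ c, InBox B c → ∀ c1', 0 ≤ c1' → c1' < c 0 →
      (0 : Fin (n+2)) ∈ X1 V Xstar Xge2 c →
      (0 : Fin (n+2)) ∈ X1 V Xstar Xge2 (Function.update c 0 c1') := by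
  intro c hc x hx0 hxc h
  have hc' : InBox B (Function.update c 0 x) := by
    intro j
    rcases eq_or_ne j 0 with rfl | hj
    · simpa using ⟨hx0, hxc.le.trans (hc 0).2⟩
    · simpa [hj] using hc j
  have hconst : Xge2 (Function.update c 0 x) = Xge2 c :=
    hXge2const _ _ fun j hj => Function.update_of_ne hj _ _
  have hnot : (0 : Fin (n+2)) ∉ Xge2 c := fun h0 => by simpa using (hXge2 c hc).1 h0
  obtain ⟨hf, hmax, htie⟩ := hXstar c hc
  obtain ⟨hf', hmax', htie'⟩ := hXstar _ hc'
  have hfeas := hf.update_of_le hxc.le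
  have hle := hmax' _ hfeas
  unfold X1 at h ⊢
  split_ifs at h with hlt
  · exact absurd h hnot
  rw [hconst, if_neg (not_lt.2 ((not_lt.1 hlt).trans hle))]
  by_contra h0
  have hfeas' := (feasible_update_iff_of_notMem h0).1 hf'
  have heq := le_antisymm hle (hmax _ hfeas')
  have hne : Xstar c ≠ Xstar (Function.update c 0 x) := fun he => h0 (he ▸ h)
  exact asymm (r := r) (htie _ hfeas' heq.symm hne.symm) (htie' _ hfeas heq hne)
end

section
/- Fix for each agent i two vectors g_i, s_i ∈ [0,B]^{n−1} such that g_i ≠ s_i for every i and such that for all agents i ≠ j and every profile c ∈ [0,B]^n it is not the case that both c_{−i} ∈ {g_i, s_i} and c_{−j} ∈ {g_j, s_j} (non-interference). Define the mechanism M on c ∈ [0,B]^n: if there is an i with c_{−i} = g_i (take the smallest such i), set x_i = 1, p_i = B, and x_j = 0, p_j = 0 for all j ≠ i; otherwise, if there is an i with c_{−i} = s_i, set x_j = 0, p_j = 0 for all j; otherwise set x_j = 1 iff j ∈ X_APX(c) and p_j = c_j·x_j. Then M satisfies NP, IR, BF, and NOM. -/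
open Finset

/-- The opposing profile `c₋ᵢ ∈ [0,B]^{n-1}`: the vector obtained from `c` by deleting
coordinate `i`. -/
def del {n : ℕ} (c : Fin (n+2) → ℝ) (i : Fin (n+2)) : Fin (n+1) → ℝ :=
  fun k => c (i.succAbove k)

open Classical in
/-- The generic golden-ticket/wooden-spoon mechanism: if some agent `i` holds their
golden ticket (`c₋ᵢ = g i`, smallest such `i`), select only `i` and pay them `B`;
otherwise, if some agent holds their wooden spoon (`c₋ᵢ = s i`), select no one;
otherwise select `APX c` at pay-as-bid prices. -/
noncomputable def ticketMech {n : ℕ} (B : ℝ) (g s : Fin (n+2) → Fin (n+1) → ℝ)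
    (APX : (Fin (n+2) → ℝ) → Finset (Fin (n+2))) (c : Fin (n+2) → ℝ) :
    (Fin (n+2) → ℝ) × (Fin (n+2) → ℝ) :=
  if hg : ∃ i, del c i = g i then
    let i := (Finset.univ.filter (fun i => del c i = g i)).min'
      (by obtain ⟨i, hi⟩ := hg
          exact ⟨i, Finset.mem_filter.mpr ⟨Finset.mem_univ i, hi⟩⟩)
    (fun j => if j = i then 1 else 0, fun j => if j = i then B else 0)
  else if ∃ i, del c i = s i then
    (fun _ => 0, fun _ => 0)
  else
    (fun j => if j ∈ APX c then 1 else 0, fun j => if j ∈ APX c then c j else 0)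

section

variable {n : ℕ} {B : ℝ} {g s : Fin (n+2) → Fin (n+1) → ℝ}
  {APX : (Fin (n+2) → ℝ) → Finset (Fin (n+2))} {c : Fin (n+2) → ℝ}

/-- When some agent holds a golden ticket, exactly one ticket holder is selected and paid `B`. -/
lemma ticketMech_of_golden (hg : ∃ i, del c i = g i) :
    ∃ i, del c i = g i ∧ ticketMech B g s APX c =
      (fun j => if j = i then 1 else 0, fun j => if j = i then B else 0) := by
  classical
  have hne : (Finset.univ.filter (fun i => del c i = g i)).Nonempty := by
    obtain ⟨i, hi⟩ := hg
    exact ⟨i, Finset.mem_filter.mpr ⟨Finset.mem_univ i, hi⟩⟩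
  refine ⟨_, (Finset.mem_filter.mp (Finset.min'_mem _ hne)).2, ?_⟩
  rw [ticketMech, dif_pos hg]

open Classical in
lemma ticketMech_of_spoon (hg : ¬∃ i, del c i = g i) (hs : ∃ i, del c i = s i) :
    ticketMech B g s APX c = (fun _ => 0, fun _ => 0) := by
  rw [ticketMech, dif_neg hg, if_pos hs]

open Classical in
lemma ticketMech_of_apx (hg : ¬∃ i, del c i = g i) (hs : ¬∃ i, del c i = s i) :
    ticketMech B g s APX c =
      (fun j => if j ∈ APX c then 1 else 0, fun j => if j ∈ APX c then c j else 0) := by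
  rw [ticketMech, dif_neg hg, if_neg hs]

/-- An agent is either unselected and unpaid, or selected and paid between their bid and `B`. -/
lemma ticketMech_outcome (hc : InBox B c) (i : Fin (n+2)) :
    ((ticketMech B g s APX c).1 i = 0 ∧ (ticketMech B g s APX c).2 i = 0) ∨
    ((ticketMech B g s APX c).1 i = 1 ∧
      (ticketMech B g s APX c).2 i ∈ Set.Icc (c i) B) := by
  by_cases hg : ∃ i, del c i = g i
  · obtain ⟨k, -, h⟩ := ticketMech_of_golden (B := B) (s := s) (APX := APX) hg
    rw [h]
    by_cases hik : i = k
    · exact Or.inr (by simpa [hik] using (hc k).2)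
    · exact Or.inl (by simp [hik])
  by_cases hs : ∃ i, del c i = s i
  · rw [ticketMech_of_spoon hg hs]
    exact Or.inl ⟨rfl, rfl⟩
  · rw [ticketMech_of_apx hg hs]
    by_cases hi : i ∈ APX c
    · exact Or.inr (by simpa [hi] using (hc i).2)
    · exact Or.inl (by simp [hi])

lemma ticketMech_budget (hB : 0 ≤ B) (hfeas : ∑ i ∈ APX c, c i ≤ B) :
    ∑ i, (ticketMech B g s APX c).2 i ≤ B := by
  by_cases hg : ∃ i, del c i = g i
  · obtain ⟨k, -, h⟩ := ticketMech_of_golden (B := B) (s := s) (APX := APX) hg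
    simp [h]
  by_cases hs : ∃ i, del c i = s i
  · simpa [ticketMech_of_spoon hg hs] using hB
  · simpa [ticketMech_of_apx hg hs] using hfeas

lemma inBox_of_ne {i : Fin (n+2)} (hi : c i ∈ Set.Icc 0 B)
    (hne : ∀ j, j ≠ i → c j ∈ Set.Icc 0 B) : InBox B c := by
  intro j
  by_cases h : j = i
  · exact h ▸ hi
  · exact hne j h

lemma utilSet_nonempty {m : ℕ} {x p : (Fin m → ℝ) → Fin m → ℝ} {i : Fin m} {t a : ℝ}
    (hB : 0 ≤ B) : (utilSet B x p i t a).Nonempty :=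
  ⟨_, Function.update 0 i a, by simp, fun j hj => by simpa [hj] using hB, rfl⟩

/-- A bid of agent `i` and an opposing profile assemble into a profile of the box. -/
lemma exists_inBox_del_eq (i : Fin (n+2)) {a : ℝ} (ha : a ∈ Set.Icc 0 B)
    {v : Fin (n+1) → ℝ} (hv : ∀ k, v k ∈ Set.Icc 0 B) :
    ∃ c : Fin (n+2) → ℝ, InBox B c ∧ c i = a ∧ del c i = v := by
  refine ⟨i.insertNth (α := fun _ => ℝ) a v, fun j => ?_, by simp, ?_⟩
  · induction j using i.succAboveCases with
    | x => simpa using ha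
    | p k => simpa using hv k
  · funext k
    simp [del]

end

/-- Given non-interfering golden tickets `g i` and wooden spoons
`s i` in `[0,B]^{n-1}` with `g i ≠ s i`, the resulting golden-ticket/wooden-spoon
mechanism satisfies NP, IR, BF, and NOM (both BNOM and WNOM). -/
theorem ticketMech_NP_IR_BF_NOM (n : ℕ) (B : ℝ) (hB : 0 < B)
    (g s : Fin (n+2) → Fin (n+1) → ℝ)
    (hgbox : ∀ i k, g i k ∈ Set.Icc (0:ℝ) B)
    (hsbox : ∀ i k, s i k ∈ Set.Icc (0:ℝ) B)
    (hgs : ∀ i, g i ≠ s i)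
    (hnoninterfere : ∀ i j : Fin (n+2), i ≠ j → ∀ c : Fin (n+2) → ℝ, InBox B c →
      ¬((del c i = g i ∨ del c i = s i) ∧ (del c j = g j ∨ del c j = s j)))
    (APX : (Fin (n+2) → ℝ) → Finset (Fin (n+2)))
    (hAPXfeas : ∀ c, InBox B c → ∑ i ∈ APX c, c i ≤ B) :
    (∀ c, InBox B c →
      (∀ i, (ticketMech B g s APX c).1 i = 0 → (ticketMech B g s APX c).2 i = 0) ∧
      (∀ i, c i * (ticketMech B g s APX c).1 i ≤ (ticketMech B g s APX c).2 i) ∧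
      (∑ i, (ticketMech B g s APX c).2 i ≤ B)) ∧
    BNOM B (fun c => (ticketMech B g s APX c).1) (fun c => (ticketMech B g s APX c).2) ∧
    WNOM B (fun c => (ticketMech B g s APX c).1) (fun c => (ticketMech B g s APX c).2) := by
  refine ⟨fun c hc => ⟨fun i h => ?_, fun i => ?_, ticketMech_budget hB.le (hAPXfeas c hc)⟩,
    fun i t ht a ha => ?_, fun i t ht a ha => ?_⟩
  · rcases ticketMech_outcome (g := g) (s := s) (APX := APX) hc i with ⟨-, hp⟩ | ⟨hx, -⟩
    · exact hp
    · exact absurd (h.symm.trans hx) zero_ne_one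
  · rcases ticketMech_outcome (g := g) (s := s) (APX := APX) hc i with ⟨hx, hp⟩ | ⟨hx, hp⟩
    · simp [hx, hp]
    · simpa [hx] using hp.1
  · have upper : ∀ b ∈ Set.Icc (0:ℝ) B, ∀ u ∈ utilSet B (fun c => (ticketMech B g s APX c).1)
        (fun c => (ticketMech B g s APX c).2) i t b, u ≤ B - t := by
      rintro b hb u ⟨c, rfl, hne, rfl⟩
      rcases ticketMech_outcome (g := g) (s := s) (APX := APX) (inBox_of_ne hb hne) i with
        ⟨hx, hp⟩ | ⟨hx, hp⟩
      · simpa [hx, hp] using ht.2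
      · simpa [hx] using hp.2
    refine (csSup_le (utilSet_nonempty hB.le) (upper a ha)).trans
      (le_csSup ⟨_, upper t ht⟩ ?_)
    obtain ⟨c, hc, hct, hdel⟩ := exists_inBox_del_eq i ht (hgbox i)
    obtain ⟨k, hk, h⟩ := ticketMech_of_golden (B := B) (s := s) (APX := APX) ⟨i, hdel⟩
    have hki : i = k := by
      by_contra hik
      exact hnoninterfere i k hik c hc ⟨Or.inl hdel, Or.inl hk⟩
    exact ⟨c, hct, fun j _ => hc j, by simp [h, hki]⟩
  · obtain ⟨c, hc, hca, hdel⟩ := exists_inBox_del_eq i ha (hsbox i)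
    have hg : ¬∃ k, del c k = g k := by
      rintro ⟨k, hk⟩
      by_cases hik : i = k
      · subst hik
        exact hgs i (hk.symm.trans hdel)
      · exact hnoninterfere i k hik c hc ⟨Or.inr hdel, Or.inl hk⟩
    have zero_mem : (0:ℝ) ∈ utilSet B (fun c => (ticketMech B g s APX c).1)
        (fun c => (ticketMech B g s APX c).2) i t a :=
      ⟨c, hca, fun j _ => hc j, by simp [ticketMech_of_spoon hg ⟨i, hdel⟩]⟩
    refine (csInf_le ⟨-t, ?_⟩ zero_mem).trans (le_csInf (utilSet_nonempty hB.le) ?_)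
    · rintro u ⟨e, rfl, hne, rfl⟩
      rcases ticketMech_outcome (g := g) (s := s) (APX := APX) (inBox_of_ne ha hne) i with
        ⟨hx, hp⟩ | ⟨hx, hp⟩
      · simpa [hx, hp] using ht.1
      · simpa [hx] using ha.1.trans hp.1
    · rintro u ⟨e, rfl, hne, rfl⟩
      rcases ticketMech_outcome (g := g) (s := s) (APX := APX) (inBox_of_ne ht hne) i with
        ⟨hx, hp⟩ | ⟨hx, hp⟩
      · simp [hx, hp]
      · simpa [hx] using hp.1
end

section
/- Let ℓ > n and, for each j ∈ {1,…,ℓ} and each agent i ∈ N, let g_i^j, s_i^j ∈ [0,B]^{n−1} be such that all 2nℓ vectors {g_i^j} ∪ {s_i^j} are pairwise distinct. Then: (a) for every c ∈ [0,B]^n, the number of indices j ∈ {1,…,ℓ} for which there exists i ∈ N with c_{−i} = g_i^j or c_{−i} = s_i^j is at most n; and (b) consequently, if V : 2^N → [0,∞) and X_APX is budget-feasible and γ-approximate (γ ≥ 1), and for each j, x^j is any allocation rule that selects exactly X_APX(c) on every profile c for which no i satisfies c_{−i} ∈ {g_i^j, s_i^j}, then for every c, (1/ℓ)·Σ_{j=1}^ℓ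 V({i : x_i^j(c) = 1}) ≥ ((ℓ−n)/ℓ)·V(X_APX(c)) ≥ ((ℓ−n)/(γℓ))·V*(c). -/
open Finset

/-- If the labels `g j i` and `s j i` are pairwise distinct, then each `d i` meets the labels of at
most one index `j`, so at most `card ι` indices are met in total. -/
theorem card_filter_exists_eq_or_eq_le {ι κ α : Type*} [Fintype ι] [Fintype κ]
    {g s : κ → ι → α}
    (h : Function.Injective
      (Sum.elim (fun q : κ × ι => g q.1 q.2) (fun q : κ × ι => s q.1 q.2)))
    (d : ι → α) [DecidablePred fun j => ∃ i, d i = g j i ∨ d i = s j i] :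
    (univ.filter fun j => ∃ i, d i = g j i ∨ d i = s j i).card ≤ Fintype.card ι := by
  refine card_le_card_of_forall_subsingleton (fun j i => d i = g j i ∨ d i = s j i)
    (t := univ) (by simp) fun i _ j hj k hk => ?_
  obtain ⟨-, hj⟩ := hj
  obtain ⟨-, hk⟩ := hk
  rcases hj with hj | hj <;> rcases hk with hk | hk
  · have := @h (.inl (j, i)) (.inl (k, i)) (hj.symm.trans hk)
    simp_all
  · have := @h (.inl (j, i)) (.inr (k, i)) (hj.symm.trans hk)
    simp_all
  · have := @h (.inr (j, i)) (.inl (k, i)) (hj.symm.trans hk)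
    simp_all
  · have := @h (.inr (j, i)) (.inr (k, i)) (hj.symm.trans hk)
    simp_all

/-- A nonnegative function that equals `a` outside a set of at most `m` exceptional indices has sum
at least `(card κ - m) * a`. -/
theorem card_sub_mul_le_sum {κ : Type*} [Fintype κ] {p : κ → Prop} [DecidablePred p]
    {f : κ → ℝ} {a : ℝ} {m : ℕ} (hf : ∀ j, 0 ≤ f j) (ha : 0 ≤ a)
    (hfa : ∀ j, ¬ p j → f j = a) (hm : (univ.filter p).card ≤ m) :
    ((Fintype.card κ - m : ℕ) : ℝ) * a ≤ ∑ j, f j := by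
  have hcard : Fintype.card κ - m ≤ (univ.filter fun j => ¬ p j).card := by
    have := card_filter_add_card_filter_not (s := (univ : Finset κ)) p
    rw [card_univ] at this
    omega
  calc ((Fintype.card κ - m : ℕ) : ℝ) * a
      ≤ ((univ.filter fun j => ¬ p j).card : ℝ) * a := by gcongr
    _ = ∑ j ∈ univ.filter fun j => ¬ p j, f j := by
      rw [sum_congr rfl fun j hj => hfa j (mem_filter.mp hj).2, sum_const, nsmul_eq_mul]
    _ ≤ ∑ j, f j := sum_le_sum_of_subset_of_nonneg (filter_subset _ _) fun j _ _ => hf j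

open Classical in
/-- Fix `ℓ > n` specifications of pairwise-distinct golden tickets
`g j i` and wooden spoons `s j i`. Then (a) at every profile `c` at most `n` of the `ℓ`
specifications are triggered, and (b) if each allocation rule `x j` selects exactly
`APX c` whenever specification `j` is not triggered at `c`, the average value of the
selected sets is at least `((ℓ-n)/ℓ)·V (APX c)`, which is at least
`((ℓ-n)/(γℓ))·V*(c)`. -/
theorem randomized_ticket_average_approx (n ℓ : ℕ) (hℓ : n + 2 < ℓ)
    (B : ℝ) (hB : 0 < B)
    (g s : Fin ℓ → Fin (n+2) → Fin (n+1) → ℝ)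
    (hgbox : ∀ j i k, g j i k ∈ Set.Icc (0:ℝ) B)
    (hsbox : ∀ j i k, s j i k ∈ Set.Icc (0:ℝ) B)
    (hdistinct : Function.Injective
      (Sum.elim (fun q : Fin ℓ × Fin (n+2) => g q.1 q.2)
        (fun q : Fin ℓ × Fin (n+2) => s q.1 q.2)))
    (V : Finset (Fin (n+2)) → ℝ) (hVnonneg : ∀ S, 0 ≤ V S)
    (γ : ℝ) (hγ : 1 ≤ γ)
    (APX : (Fin (n+2) → ℝ) → Finset (Fin (n+2)))
    (hAPXfeas : ∀ c, InBox B c → ∑ i ∈ APX c, c i ≤ B)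
    (hAPXapprox : ∀ c, InBox B c → ∀ S : Finset (Fin (n+2)),
      ∑ i ∈ S, c i ≤ B → V S ≤ γ * V (APX c))
    (x : Fin ℓ → (Fin (n+2) → ℝ) → Fin (n+2) → ℝ)
    (hx : ∀ j, ∀ c, InBox B c → (∀ i, del c i ≠ g j i ∧ del c i ≠ s j i) →
      ∀ i, x j c i = 1 ↔ i ∈ APX c) :
    ∀ c, InBox B c →
      ((Finset.univ.filter
          (fun j : Fin ℓ => ∃ i, del c i = g j i ∨ del c i = s j i)).card ≤ n + 2) ∧
      (((ℓ - (n+2) : ℕ) : ℝ) / ℓ * V (APX c) ≤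
        (1 / (ℓ : ℝ)) * ∑ j : Fin ℓ, V (Finset.univ.filter fun i => x j c i = 1)) ∧
      (∀ S : Finset (Fin (n+2)), ∑ i ∈ S, c i ≤ B →
        ((ℓ - (n+2) : ℕ) : ℝ) / (γ * ℓ) * V S ≤
          (1 / (ℓ : ℝ)) * ∑ j : Fin ℓ, V (Finset.univ.filter fun i => x j c i = 1)) := by
  intro c hc
  have hcard : (univ.filter fun j : Fin ℓ => ∃ i, del c i = g j i ∨ del c i = s j i).card
      ≤ n + 2 := by
    simpa using card_filter_exists_eq_or_eq_le hdistinct (del c)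
  have hsum := card_sub_mul_le_sum
    (f := fun j : Fin ℓ => V (univ.filter fun i => x j c i = 1))
    (fun j => hVnonneg _) (hVnonneg (APX c))
    (fun j hj => by
      push Not at hj
      congr 1
      ext i
      simpa using hx j c hc hj i) hcard
  rw [Fintype.card_fin] at hsum
  have hℓ0 : (0 : ℝ) < ℓ := by exact_mod_cast (by omega : 0 < ℓ)
  have hγ0 : 0 < γ := by linarith
  have havg : ((ℓ - (n+2) : ℕ) : ℝ) / ℓ * V (APX c) ≤
      (1 / (ℓ : ℝ)) * ∑ j : Fin ℓ, V (univ.filter fun i => x j c i = 1) := by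
    rw [div_mul_eq_mul_div, one_div_mul_eq_div]
    gcongr
  refine ⟨hcard, havg, fun S hS => le_trans ?_ havg⟩
  calc ((ℓ - (n+2) : ℕ) : ℝ) / (γ * ℓ) * V S
      ≤ ((ℓ - (n+2) : ℕ) : ℝ) / (γ * ℓ) * (γ * V (APX c)) := by
        gcongr
        exact hAPXapprox c hc S hS
    _ = ((ℓ - (n+2) : ℕ) : ℝ) / ℓ * V (APX c) := by field_simp
end

section
/- Fix c_{−1} ∈ [0,B]^{n−1}. The tie-broken knapsack optimizer is eventually constant from the left in agent 1's cost: for every w ∈ (0,B] there exists ε ∈ (0,w] such that the set X*((c_1,c_{−1}),B) is the same subset of N for all c_1 ∈ [w−ε, w). -/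
open Finset

open Filter Topology

theorem InBox.update {n : ℕ} {B : ℝ} {c : Fin n → ℝ} (hc : InBox B c) (i : Fin n) {x : ℝ}
    (hx : x ∈ Set.Icc 0 B) : InBox B (Function.update c i x) := by
  intro j
  rcases eq_or_ne j i with rfl | hj
  · simpa using hx
  · simpa [hj] using hc j

theorem Feasible.mono {n : ℕ} {B : ℝ} {c d : Fin n → ℝ} {S : Finset (Fin n)}
    (h : Feasible B d S) (hcd : c ≤ d) : Feasible B c S :=
  (Finset.sum_le_sum fun i _ => hcd i).trans h

/-- Just to the left of `w`, exactly the sets that are feasible at `w` are feasible. -/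
theorem eventually_feasible_update_iff {n : ℕ} (B : ℝ) (c : Fin n → ℝ) (i : Fin n) (w : ℝ) :
    ∀ᶠ x in 𝓝[<] w, ∀ S : Finset (Fin n),
      Feasible B (Function.update c i x) S ↔ Feasible B (Function.update c i w) S := by
  rw [eventually_all]
  intro S
  by_cases h : Feasible B (Function.update c i w) S
  · filter_upwards [self_mem_nhdsWithin] with x hx
    exact iff_of_true (h.mono (update_le_update_iff'.2 (le_of_lt hx))) h
  · have hcont : Continuous fun x => ∑ j ∈ S, Function.update c i x j :=
      continuous_finsetSum S fun j _ =>
        (continuous_apply (A := fun _ => ℝ) j).comp (continuous_const.update i continuous_id)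
    filter_upwards [(hcont.continuousAt.eventually_const_lt (not_le.1 h)).filter_mono
      nhdsWithin_le_nhds] with x hx
    exact iff_of_false (not_le.2 hx) h

/-- A tie-broken maximizer is determined by the collection of admissible alternatives. -/
theorem eq_of_tieBroken_maximizer {α : Type*} {r : α → α → Prop} [Std.Asymm r] {V : α → ℝ}
    {p q : α → Prop} (hpq : ∀ s, p s ↔ q s) {a b : α} (ha : p a) (hb : q b)
    (hVa : ∀ s, p s → V s ≤ V a) (hVb : ∀ s, q s → V s ≤ V b)
    (hra : ∀ s, p s → V s = V a → s ≠ a → r a s)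
    (hrb : ∀ s, q s → V s = V b → s ≠ b → r b s) : a = b := by
  by_contra hab
  have hpb := (hpq b).2 hb
  have hqa := (hpq a).1 ha
  have hV : V a = V b := le_antisymm (hVb a hqa) (hVa b hpb)
  exact Std.Asymm.asymm _ _ (hra b hpb hV.symm (Ne.symm hab)) (hrb a hqa hV hab)

/-- Fix the reports of all agents other than agent `0`. The
tie-broken knapsack optimizer `Xstar` is eventually constant from the left in agent
`0`'s cost: for every `w ∈ (0,B]` there is `ε ∈ (0,w]` such that `Xstar` returns the
same set at every profile obtained from `c` by setting agent `0`'s cost to any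
`c₁ ∈ [w-ε, w)`. -/
theorem Xstar_left_constant (n : ℕ) (B : ℝ) (hB : 0 < B)
    (V : Finset (Fin (n+2)) → ℝ) (hVnonneg : ∀ S, 0 ≤ V S)
    (r : Finset (Fin (n+2)) → Finset (Fin (n+2)) → Prop)
    (hr : IsStrictTotalOrder (Finset (Fin (n+2))) r)
    (Xstar : (Fin (n+2) → ℝ) → Finset (Fin (n+2)))
    (hXstar : ∀ c, InBox B c → Feasible B c (Xstar c) ∧
      (∀ S, Feasible B c S → V S ≤ V (Xstar c)) ∧
      (∀ S, Feasible B c S → V S = V (Xstar c) → S ≠ Xstar c → r (Xstar c) S)) :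
    ∀ c, InBox B c → ∀ w, 0 < w → w ≤ B →
      ∃ ε, 0 < ε ∧ ε ≤ w ∧ ∃ S : Finset (Fin (n+2)),
        ∀ c1, w - ε ≤ c1 → c1 < w → Xstar (Function.update c 0 c1) = S := by
  intro c hc w hw hwB
  obtain ⟨l, ⟨hl0, hlw⟩, hl⟩ := (mem_nhdsLT_iff_exists_mem_Ico_Ioo_subset hw).1
    (eventually_feasible_update_iff B c 0 w)
  refine ⟨(w - l) / 2, by linarith [hlw], by linarith,
    Xstar (Function.update c 0 w), fun x hx hxw => ?_⟩
  have hlx : l < x := by linarith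
  obtain ⟨hfx, hVx, hrx⟩ := hXstar _ (hc.update 0 ⟨(hl0.trans_lt hlx).le, hxw.le.trans hwB⟩)
  obtain ⟨hfw, hVw, hrw⟩ := hXstar _ (hc.update 0 ⟨hw.le, hwB⟩)
  exact eq_of_tieBroken_maximizer (hl ⟨hlx, hxw⟩) hfx hfw hVx hVw hrx hrw
end
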